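/- Let M₁, M₂ be countably compact n₁- and n₂-manifolds with dim M_i = m_i, and suppose max{ n₁ + m₂, n₂ + m₁ } ≤ dim(M₁* × M₂*), where M_i* = βM_i \ M_i. Then dim(M₁ × M₂) = dim(M₁* × M₂*). -/

import Mathlib

open Set Topology

universe u v w

/-- An abstract simplicial complex on a vertex set `V`. -/
structure SimpComplex (V : Type v) where
  faces : Set (Finset V)
  down_closed : ∀ s ∈ faces, ∀ t, t ⊆ s → t.Nonempty → t ∈ faces

/-- The geometric realization of a simplicial complex with the metric (ℓ¹) topology,
realized inside the Banach space `ℓ¹(V)`. -/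
def SimpComplex.space {V : Type v} (K : SimpComplex V) : Set (lp (fun _ : V => ℝ) 1) :=
  {f | ∃ s ∈ K.faces, (∀ v : V, (f : ∀ _ : V, ℝ) v ≠ 0 → v ∈ s) ∧
    (∀ v : V, 0 ≤ (f : ∀ _ : V, ℝ) v) ∧ ∑ v ∈ s, (f : ∀ _ : V, ℝ) v = 1}

/-- `Z` is an absolute extensor of `X`: every continuous map from a closed subset of `X`
into `Z` extends continuously over all of `X`. -/
def IsAE (Z X : Type*) [TopologicalSpace Z] [TopologicalSpace X] : Prop :=
  ∀ Y : Set X, IsClosed Y → ∀ f : C(Y, Z), ∃ g : C(X, Z), ∀ y : Y, g y = f y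

/-- `Z` is an absolute neighborhood extensor of `X`. -/
def IsANE (Z X : Type*) [TopologicalSpace Z] [TopologicalSpace X] : Prop :=
  ∀ Y : Set X, IsClosed Y → ∀ f : C(Y, Z),
    ∃ U : Set X, IsOpen U ∧ Y ⊆ U ∧ ∃ g : C(U, Z),
      ∀ (y : Y) (h : (y : X) ∈ U), g ⟨y, h⟩ = f y

/-- A space is countably compact if every countable open cover has a finite subcover. -/
def CountablyCompact (X : Type*) [TopologicalSpace X] : Prop :=
  ∀ 𝒰 : ℕ → Set X, (∀ n, IsOpen (𝒰 n)) → (⋃ n, 𝒰 n) = univ →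
    ∃ t : Finset ℕ, (⋃ n ∈ t, 𝒰 n) = univ

/-- A set is functionally open if it is the cozero set of a real-valued continuous function. -/
def FunctionallyOpen {X : Type*} [TopologicalSpace X] (U : Set X) : Prop :=
  ∃ φ : C(X, ℝ), U = φ ⁻¹' ({0}ᶜ)

/-- `CovDimLE X n` : every finite functionally open cover of `X` has a finite functionally
open refinement of order at most `n + 1` (any `n + 2` distinct members meet emptily). -/
def CovDimLE (X : Type*) [TopologicalSpace X] (n : ℕ) : Prop :=
  ∀ 𝒰 : Finset (Set X), (∀ U ∈ 𝒰, FunctionallyOpen U) → ⋃₀ (𝒰 : Set (Set X)) = univ →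
    ∃ 𝒱 : Finset (Set X), (∀ V ∈ 𝒱, FunctionallyOpen V) ∧ ⋃₀ (𝒱 : Set (Set X)) = univ ∧
      (∀ V ∈ 𝒱, ∃ U ∈ 𝒰, V ⊆ U) ∧
      ∀ 𝒲 : Finset (Set X), 𝒲 ⊆ 𝒱 → n + 1 < 𝒲.card → ⋂₀ (𝒲 : Set (Set X)) = ∅

/-- The covering dimension of `X` as an extended natural number (`⊤` if no finite bound). -/
noncomputable def covDim (X : Type*) [TopologicalSpace X] : ℕ∞ :=
  sInf ((↑) '' {n : ℕ | CovDimLE X n})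

/-- The Stone–Čech remainder `βX \ X`. -/
def StoneCechRemainder (X : Type*) [TopologicalSpace X] : Set (StoneCech X) :=
  (range (stoneCechUnit : X → StoneCech X))ᶜ

/-- `M` is an `n`-manifold: every point has an open neighborhood homeomorphic to `ℝⁿ`. -/
def IsTopManifold (M : Type*) [TopologicalSpace M] (n : ℕ) : Prop :=
  ∀ x : M, ∃ U : Set M, IsOpen U ∧ x ∈ U ∧ Nonempty (↥U ≃ₜ EuclideanSpace ℝ (Fin n))

/-- `A` is `n`-good in `X`: finite open covers can be shrunk to have order at most `n + 1`
on a neighbourhood of `A`. -/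
def Good {X : Type u} [TopologicalSpace X] (A : Set X) (n : ℕ) : Prop :=
  ∀ (ι : Type u) [Finite ι] (U : ι → Set X), (∀ i, IsOpen (U i)) → (∀ x, ∃ i, x ∈ U i) →
    ∃ V : ι → Set X, (∀ i, IsOpen (V i)) ∧ (∀ i, V i ⊆ U i) ∧ (∀ x, ∃ i, x ∈ V i) ∧
      ∃ W : Set X, IsOpen W ∧ A ⊆ W ∧ ∀ x ∈ W, {i | x ∈ V i}.ncard ≤ n + 1

theorem functional_shrink {X : Type u} [TopologicalSpace X] [NormalSpace X] {ι : Type w} [Finite ι]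
    (U : ι → Set X) (hU : ∀ i, IsOpen (U i)) (hc : ∀ x, ∃ i, x ∈ U i) :
    ∃ g : ι → C(X, ℝ), (∀ i x, 0 ≤ g i x) ∧ (∀ i x, g i x ≠ 0 → x ∈ U i) ∧
      ∀ x, ∃ i, 0 < g i x := by
  obtain ⟨F, hF, hFc, hFU⟩ := exists_iUnion_eq_closed_subset hU (fun x => Set.toFinite _)
    (by ext x; simpa using hc x)
  have : ∀ i, ∃ f : C(X, ℝ), EqOn f 0 (U i)ᶜ ∧ EqOn f 1 (F i) ∧ ∀ x, f x ∈ Icc (0 : ℝ) 1 :=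
    fun i => exists_continuous_zero_one_of_isClosed (hU i).isClosed_compl (hFc i)
      (Set.disjoint_left.2 fun x hx hx' => hx (hFU i hx'))
  choose g h0 h1 h2 using this
  refine ⟨g, fun i x => (h2 i x).1, fun i x hx => ?_, fun x => ?_⟩
  · by_contra h
    exact hx (h0 i h)
  · have : x ∈ iUnion F := hF ▸ mem_univ x
    obtain ⟨i, hi⟩ := mem_iUnion.1 this
    refine ⟨i, ?_⟩
    rw [h1 i hi]
    simp

theorem CovDimLE.mono {X : Type*} [TopologicalSpace X] {n m : ℕ} (h : CovDimLE X n) (hnm : n ≤ m) :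
    CovDimLE X m := by
  intro 𝒰 h1 h2
  obtain ⟨𝒱, a, b, c, d⟩ := h 𝒰 h1 h2
  exact ⟨𝒱, a, b, c, fun 𝒲 h3 h4 => d 𝒲 h3 (by omega)⟩

theorem CovDimLE.idx {X : Type u} [TopologicalSpace X] {n : ℕ} (h : CovDimLE X n)
    {ι : Type w} [Finite ι] (g : ι → C(X, ℝ)) (hg : ∀ x, ∃ i, g i x ≠ 0) :
    ∃ k : ι → C(X, ℝ), (∀ i x, 0 ≤ k i x) ∧ (∀ i x, k i x ≠ 0 → g i x ≠ 0) ∧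
      (∀ x, ∃ i, k i x ≠ 0) ∧ ∀ x, {i | k i x ≠ 0}.ncard ≤ n + 1 := by
  classical
  have := Fintype.ofFinite ι
  rcases isEmpty_or_nonempty ι with hι | hι
  · have hX : IsEmpty X := ⟨fun x => (hg x).elim fun i _ => hι.elim i⟩
    exact ⟨g, fun i => hι.elim i, fun i => hι.elim i, hg, fun x => hX.elim x⟩
  let co : ι → Set X := fun i => g i ⁻¹' ({0}ᶜ)
  obtain ⟨𝒱, h1, h2, h3, h4⟩ := h (Finset.univ.image co)
    (by
      intro U hU
      obtain ⟨i, _, rfl⟩ := Finset.mem_image.1 hU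
      exact ⟨g i, rfl⟩)
    (by
      ext x
      obtain ⟨i, hi⟩ := hg x
      simp only [Finset.coe_image, Finset.coe_univ, image_univ, sUnion_range, mem_iUnion, mem_univ,
        iff_true]
      exact ⟨i, hi⟩)
  have h3' : ∀ V ∈ 𝒱, ∃ i, V ⊆ co i := by
    intro V hV
    obtain ⟨U, hU, hVU⟩ := h3 V hV
    obtain ⟨i, _, rfl⟩ := Finset.mem_image.1 hU
    exact ⟨i, hVU⟩
  choose! r hr using h3'
  have h1' : ∀ V ∈ 𝒱, ∃ φ : C(X, ℝ), ∀ x, x ∈ V ↔ φ x ≠ 0 := by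
    intro V hV
    obtain ⟨φ, rfl⟩ := h1 V hV
    exact ⟨φ, fun x => Iff.rfl⟩
  choose! φ hφ using h1'
  let k : ι → C(X, ℝ) := fun i =>
    ⟨fun x => ∑ V ∈ 𝒱.filter (fun V => r V = i), |φ V x|, by fun_prop⟩
  have hk : ∀ i x, k i x ≠ 0 ↔ ∃ V ∈ 𝒱, r V = i ∧ x ∈ V := by
    intro i x
    have hk0 : k i x = ∑ V ∈ 𝒱.filter (fun V => r V = i), |φ V x| := rfl
    rw [hk0, Ne, Finset.sum_eq_zero_iff_of_nonneg (fun _ _ => abs_nonneg _)]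
    push Not
    constructor
    · rintro ⟨V, hV, hx⟩
      obtain ⟨hV, hi⟩ := Finset.mem_filter.1 hV
      exact ⟨V, hV, hi, (hφ V hV x).2 (abs_ne_zero.1 hx)⟩
    · rintro ⟨V, hV, hi, hx⟩
      exact ⟨V, Finset.mem_filter.2 ⟨hV, hi⟩, abs_ne_zero.2 ((hφ V hV x).1 hx)⟩
  refine ⟨k, ?_, ?_, ?_, ?_⟩
  · intro i x
    exact Finset.sum_nonneg fun _ _ => abs_nonneg _
  · intro i x hx
    obtain ⟨V, hV, rfl, hxV⟩ := (hk i x).1 hx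
    exact hr V hV hxV
  · intro x
    have : x ∈ ⋃₀ (𝒱 : Set (Set X)) := h2 ▸ mem_univ x
    obtain ⟨V, hV, hx⟩ := this
    exact ⟨r V, (hk _ _).2 ⟨V, hV, rfl, hx⟩⟩
  · intro x
    let 𝒲 := 𝒱.filter (fun V => x ∈ V)
    have hW : 𝒲.card ≤ n + 1 := by
      by_contra hlt
      have := h4 𝒲 (Finset.filter_subset _ _) (by omega)
      have hx : x ∈ ⋂₀ (𝒲 : Set (Set X)) := by
        intro V hV
        exact (Finset.mem_filter.1 hV).2
      rw [this] at hx
      exact hx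
    refine le_trans ?_ (le_trans (Finset.card_image_le (f := r) (s := 𝒲)) hW)
    rw [← Set.ncard_coe_finset]
    apply Set.ncard_le_ncard _ (Finset.finite_toSet _)
    intro i hi
    obtain ⟨V, hV, rfl, hxV⟩ := (hk i x).1 hi
    exact Finset.mem_coe.2 (Finset.mem_image_of_mem r (Finset.mem_filter.2 ⟨hV, hxV⟩))

/-- Converse packaging: functional indexed refinement gives `CovDimLE`. -/
theorem covDimLE_of_idx {X : Type u} [TopologicalSpace X] {n : ℕ}
    (h : ∀ (ι : Type u) [Fintype ι] (g : ι → C(X, ℝ)), (∀ x, ∃ i, g i x ≠ 0) →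
      ∃ k : ι → C(X, ℝ), (∀ i x, k i x ≠ 0 → g i x ≠ 0) ∧ (∀ x, ∃ i, k i x ≠ 0) ∧
        ∀ x, {i | k i x ≠ 0}.ncard ≤ n + 1) : CovDimLE X n := by
  classical
  intro 𝒰 h1 h2
  have : ∀ U : 𝒰, ∃ φ : C(X, ℝ), (U : Set X) = φ ⁻¹' ({0}ᶜ) := fun U => h1 U U.2
  choose g hg using this
  obtain ⟨k, hk1, hk2, hk3⟩ := h 𝒰 g (by
    intro x
    have : x ∈ ⋃₀ (𝒰 : Set (Set X)) := h2 ▸ mem_univ x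
    obtain ⟨U, hU, hx⟩ := this
    refine ⟨⟨U, hU⟩, ?_⟩
    have := hg ⟨U, hU⟩
    simp only at this
    rw [this] at hx
    exact hx)
  let co : 𝒰 → Set X := fun i => k i ⁻¹' ({0}ᶜ)
  refine ⟨Finset.univ.image co, ?_, ?_, ?_, ?_⟩
  · intro V hV
    obtain ⟨i, _, rfl⟩ := Finset.mem_image.1 hV
    exact ⟨k i, rfl⟩
  · ext x
    obtain ⟨i, hi⟩ := hk2 x
    simp only [Finset.coe_image, Finset.coe_univ, image_univ, sUnion_range, mem_iUnion, mem_univ,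
      iff_true]
    exact ⟨i, hi⟩
  · intro V hV
    obtain ⟨i, _, rfl⟩ := Finset.mem_image.1 hV
    refine ⟨i, i.2, ?_⟩
    intro x hx
    rw [hg i]
    exact hk1 i x hx
  · intro 𝒲 hW hcard
    by_contra hne
    obtain ⟨x, hx⟩ := Set.nonempty_iff_ne_empty.2 hne
    have : 𝒲 ⊆ (Finset.univ.filter (fun i => k i x ≠ 0)).image co := by
      intro V hV
      obtain ⟨i, _, rfl⟩ := Finset.mem_image.1 (hW hV)
      refine Finset.mem_image_of_mem co (Finset.mem_filter.2 ⟨Finset.mem_univ _, ?_⟩)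
      exact hx _ hV
    have h5 := (Finset.card_le_card this).trans Finset.card_image_le
    have h6 := hk3 x
    rw [Set.ncard_eq_toFinset_card'] at h6
    simp only [Set.toFinset_ofPred] at h6
    omega

theorem Good.covDimLE {X : Type u} [TopologicalSpace X] [NormalSpace X] {n : ℕ}
    (h : Good (univ : Set X) n) : CovDimLE X n := by
  apply covDimLE_of_idx
  intro ι _ g hg
  obtain ⟨V, hV, hVU, hVc, W, hW, hAW, hn⟩ := h ι (fun i => g i ⁻¹' ({0}ᶜ))
    (fun i => isOpen_compl_singleton.preimage (g i).continuous) hg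
  obtain ⟨k, _, hk, hk'⟩ := functional_shrink V hV hVc
  refine ⟨k, fun i x hx => hVU i (hk i x hx), fun x => ?_, fun x => ?_⟩
  · obtain ⟨i, hi⟩ := hk' x
    exact ⟨i, hi.ne'⟩
  · exact (Set.ncard_le_ncard (fun i hi => hk i x hi)).trans (hn x (hAW trivial))

theorem CovDimLE.good_range {X C : Type u} [TopologicalSpace X] [NormalSpace X]
    [TopologicalSpace C] {n : ℕ} (h : CovDimLE C n) {f : C → X} (hf : IsClosedEmbedding f) :
    Good (range f) n := by
  classical
  have hNC : NormalSpace C := hf.normalSpace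
  intro ι _ U hU hUc
  have := Fintype.ofFinite ι
  obtain ⟨g, -, hgU, hg⟩ := functional_shrink (fun i => f ⁻¹' (U i))
    (fun i => (hU i).preimage hf.continuous) (fun x => hUc (f x))
  obtain ⟨k, hk0, hkg, hk, hVn⟩ := h.idx g (fun x => (hg x).imp fun i hi => hi.ne')
  have : ∀ i, ∃ H : C(X, ℝ), H ∘ f = k i := fun i => (k i).exists_extension' hf
  choose H hH using this
  have hH' : ∀ i c, H i (f c) = k i c := fun i c => congrFun (hH i) c
  let O : ι → Set X := fun i => {x | x ∈ U i ∧ 0 < H i x ∧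
    (Finset.univ.filter fun j => H i x ≤ H j x).card ≤ n + 1}
  have hO : ∀ i, IsOpen (O i) := by
    intro i
    have : O i = U i ∩ {x | 0 < H i x} ∩
        ⋂ s ∈ {s : Finset ι | n + 1 < s.card}, {x | ∃ j ∈ s, H j x < H i x} := by
      ext x
      simp only [O, mem_ofPred_eq, mem_inter_iff, mem_iInter, and_assoc]
      refine and_congr_right fun _ => and_congr_right fun _ => ⟨fun hx s hs => ?_, fun hx => ?_⟩
      · by_contra! hcon
        have : s ⊆ Finset.univ.filter fun j => H i x ≤ H j x := by
          intro j hj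
          simpa using hcon j hj
        have := Finset.card_le_card this
        omega
      · by_contra! hcon
        obtain ⟨j, hj, hlt⟩ := hx _ hcon
        simp only [Finset.mem_filter, Finset.mem_univ, true_and] at hj
        linarith
    rw [this]
    refine ((hU i).inter (isOpen_lt continuous_const (H i).continuous)).inter ?_
    refine Set.Finite.isOpen_biInter (Set.toFinite _) fun s _ => ?_
    have : {x | ∃ j ∈ s, H j x < H i x} = ⋃ j ∈ s, {x | H j x < H i x} := by
      ext x; simp
    rw [this]
    exact isOpen_biUnion fun j _ => isOpen_lt (H j).continuous (H i).continuous
  have hOn : ∀ x, {i | x ∈ O i}.ncard ≤ n + 1 := by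
    intro x
    by_cases hne : (Finset.univ.filter fun i => x ∈ O i).Nonempty
    · obtain ⟨i, hi, hmin⟩ := Finset.exists_min_image _ (fun i => H i x) hne
      simp only [Finset.mem_filter, Finset.mem_univ, true_and] at hi hmin
      refine le_trans ?_ hi.2.2
      rw [← Set.ncard_coe_finset]
      apply Set.ncard_le_ncard _ (Finset.finite_toSet _)
      intro j hj
      simpa using hmin j hj
    · have : {i | x ∈ O i} = ∅ := by
        ext i
        simp only [mem_ofPred_eq, mem_empty_iff_false, iff_false]
        intro hi
        exact hne ⟨i, by simpa using hi⟩
      rw [this]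
      simp
  have hOc : range f ⊆ ⋃ i, O i := by
    rintro _ ⟨c, rfl⟩
    obtain ⟨i, hi⟩ := hk c
    refine mem_iUnion.2 ⟨i, ?_, ?_, ?_⟩
    · exact hgU i c (hkg i c hi)
    · rw [hH']; exact lt_of_le_of_ne (hk0 i c) hi.symm
    · refine le_trans ?_ (hVn c)
      rw [← Set.ncard_coe_finset]
      apply Set.ncard_le_ncard _ (Set.toFinite _)
      intro j hj
      simp only [Finset.coe_filter, Finset.mem_univ, true_and, mem_ofPred_eq, hH'] at hj
      have := lt_of_le_of_ne (hk0 i c) hi.symm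
      exact (this.trans_le hj).ne'
  obtain ⟨W, hW, hAW, hWO⟩ := normal_exists_closure_subset hf.isClosed_range
    (isOpen_iUnion hO) hOc
  refine ⟨fun i => (U i \ closure W) ∪ O i, ?_, ?_, ?_, W, hW, hAW, ?_⟩
  · exact fun i => ((hU i).sdiff isClosed_closure).union (hO i)
  · rintro i x (hx | hx)
    exacts [hx.1, hx.1]
  · intro x
    by_cases hx : x ∈ closure W
    · obtain ⟨i, hi⟩ := mem_iUnion.1 (hWO hx)
      exact ⟨i, Or.inr hi⟩
    · obtain ⟨i, hi⟩ := hUc x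
      exact ⟨i, Or.inl ⟨hi, hx⟩⟩
  · intro x hx
    refine le_trans (Set.ncard_le_ncard ?_ (Set.toFinite _)) (hOn x)
    rintro i (hi | hi)
    · exact absurd (subset_closure hx) hi.2
    · exact hi

theorem CovDimLE.good {X : Type u} [TopologicalSpace X] [NormalSpace X] {n : ℕ}
    (h : CovDimLE X n) : Good (univ : Set X) n := by
  have := h.good_range (f := (id : X → X)) IsClosedEmbedding.id
  rwa [range_id] at this

theorem Good.mono {X : Type u} [TopologicalSpace X] {A B : Set X} {n : ℕ} (h : Good B n)
    (hAB : A ⊆ B) : Good A n := by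
  intro ι _ U hU hc
  obtain ⟨V, a, b, c, W, d, e, f⟩ := h ι U hU hc
  exact ⟨V, a, b, c, W, d, hAB.trans e, f⟩

theorem Good.empty {X : Type u} [TopologicalSpace X] {n : ℕ} : Good (∅ : Set X) n := by
  intro ι _ U hU hc
  exact ⟨U, hU, fun i => le_rfl, hc, ∅, isOpen_empty, le_rfl, fun x hx => hx.elim⟩

theorem Good.union {X : Type u} [TopologicalSpace X] {A B : Set X} {n : ℕ} (hA : Good A n)
    (hB : Good B n) : Good (A ∪ B) n := by
  intro ι _ U hU hc
  obtain ⟨V, a, b, c, W, d, e, f⟩ := hA ι U hU hc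
  obtain ⟨V', a', b', c', W', d', e', f'⟩ := hB ι V a c
  refine ⟨V', a', fun i => (b' i).trans (b i), c', W ∪ W', d.union d', union_subset_union e e', ?_⟩
  rintro x (hx | hx)
  · exact (Set.ncard_le_ncard (fun i hi => b' i hi) (Set.toFinite _)).trans (f x hx)
  · exact f' x hx

theorem good_univ_of_local {X : Type u} [TopologicalSpace X] [CompactSpace X] {A : Set X} {n : ℕ}
    (hA : Good A n) (h : ∀ x ∉ A, ∃ N ∈ 𝓝 x, Good N n) : Good (univ : Set X) n := by
  intro ι _ U hU hc
  obtain ⟨V, a, b, c, W, d, e, f⟩ := hA ι U hU hc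
  have hB : Good Wᶜ n := by
    refine d.isClosed_compl.isCompact.induction_on Good.empty (fun s t hst ht => ht.mono hst)
      (fun s t hs ht => hs.union ht) ?_
    intro x hx
    obtain ⟨N, hN, hN'⟩ := h x (fun hxA => hx (e hxA))
    exact ⟨N, mem_nhdsWithin_of_mem_nhds hN, hN'⟩
  obtain ⟨V', a', b', c', W', d', e', f'⟩ := hB ι V a c
  refine ⟨V', a', fun i => (b' i).trans (b i), c', univ, isOpen_univ, le_rfl, ?_⟩
  intro x _
  by_cases hx : x ∈ W
  · exact (Set.ncard_le_ncard (fun i hi => b' i hi) (Set.toFinite _)).trans (f x hx)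
  · exact f' x (e' hx)

theorem CovDimLE.of_closedEmbedding {X C : Type u} [TopologicalSpace X] [NormalSpace X]
    [TopologicalSpace C] {n : ℕ} (h : CovDimLE X n) {f : C → X} (hf : IsClosedEmbedding f) :
    CovDimLE C n := by
  have hNC : NormalSpace C := hf.normalSpace
  apply Good.covDimLE
  intro ι _ U hU hc
  have : ∀ i, ∃ U' : Set X, IsOpen U' ∧ f ⁻¹' U' = U i := fun i => hf.isInducing.isOpen_iff.1 (hU i)
  choose U' hU' hUU using this
  obtain ⟨V, a, b, c, W, d, e, k⟩ := h.good (Option ι) (fun o => o.elim (range f)ᶜ U')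
    (by
      rintro (_ | i)
      · exact hf.isClosed_range.isOpen_compl
      · exact hU' i)
    (by
      intro x
      by_cases hx : x ∈ range f
      · obtain ⟨y, rfl⟩ := hx
        obtain ⟨i, hi⟩ := hc y
        refine ⟨some i, ?_⟩
        rw [← hUU i] at hi
        exact hi
      · exact ⟨none, hx⟩)
  refine ⟨fun i => f ⁻¹' V (some i), fun i => (a _).preimage hf.continuous, ?_, ?_, univ,
    isOpen_univ, le_rfl, ?_⟩
  · intro i
    rw [← hUU i]
    exact preimage_mono (b (some i))
  · intro x
    obtain ⟨(_ | i), hi⟩ := c (f x)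
    · exact absurd ⟨x, rfl⟩ (b none hi)
    · exact ⟨i, hi⟩
  · intro x _
    refine le_trans ?_ (k (f x) (e trivial))
    rw [← Set.ncard_image_of_injective _ (Option.some_injective ι)]
    refine Set.ncard_le_ncard ?_ (Set.toFinite _)
    rintro _ ⟨i, hi, rfl⟩
    exact hi

theorem exists_normalized {X : Type u} [TopologicalSpace X] {ι : Type w} [Fintype ι]
    (g : ι → C(X, ℝ)) (hg : ∀ x, ∃ i, g i x ≠ 0) :
    ∃ p : ι → C(X, unitInterval), (∀ i x, (p i x : ℝ) ≠ 0 ↔ g i x ≠ 0) ∧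
      ∀ x, ∑ i, (p i x : ℝ) = 1 := by
  have hpos : ∀ x, 0 < ∑ i, |g i x| := by
    intro x
    obtain ⟨i, hi⟩ := hg x
    exact Finset.sum_pos' (fun _ _ => abs_nonneg _) ⟨i, Finset.mem_univ _, abs_pos.2 hi⟩
  have hle : ∀ i x, |g i x| ≤ ∑ i, |g i x| := fun i x =>
    Finset.single_le_sum (f := fun i => |g i x|) (fun _ _ => abs_nonneg _) (Finset.mem_univ i)
  have hcont : ∀ i, Continuous fun x => |g i x| / ∑ j, |g j x| := fun i =>
    Continuous.div (by fun_prop) (by fun_prop) (fun x => (hpos x).ne')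
  refine ⟨fun i => ⟨fun x => ⟨|g i x| / ∑ j, |g j x|,
    div_nonneg (abs_nonneg _) (hpos x).le, (div_le_one (hpos x)).2 (hle i x)⟩,
    (hcont i).subtype_mk _⟩, ?_, ?_⟩
  · intro i x
    simp [(hpos x).ne']
  · intro x
    simp only [ContinuousMap.coe_mk]
    rw [← Finset.sum_div, div_self (hpos x).ne']

theorem exists_extended {X K : Type u} [TopologicalSpace X] [TopologicalSpace K] {e : X → K}
    (hd : DenseRange e)
    (hext : ∀ f : C(X, unitInterval), ∃ F : C(K, unitInterval), ∀ x, F (e x) = f x)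
    {ι : Type w} [Fintype ι] (g : ι → C(X, ℝ)) (hg : ∀ x, ∃ i, g i x ≠ 0) :
    ∃ P : ι → C(K, ℝ), (∀ i x, P i (e x) ≠ 0 ↔ g i x ≠ 0) ∧ ∀ z, ∑ i, P i z = 1 := by
  obtain ⟨p, hp, hs⟩ := exists_normalized g hg
  choose F hF using hext
  refine ⟨fun i => ⟨fun z => (F (p i) z : ℝ), by fun_prop⟩, ?_, ?_⟩
  · intro i x
    simp only [ContinuousMap.coe_mk, hF]
    exact hp i x
  · intro z
    have : (fun z => ∑ i, (F (p i) z : ℝ)) = fun _ => 1 := by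
      apply hd.equalizer (by fun_prop) continuous_const
      ext x
      simp only [Function.comp, hF]
      exact hs x
    exact congrFun this z

theorem covDimLE_iff_of_ext {X K : Type u} [TopologicalSpace X] [TopologicalSpace K]
    {e : X → K} (hd : DenseRange e) (he : Continuous e)
    (hext : ∀ f : C(X, unitInterval), ∃ F : C(K, unitInterval), ∀ x, F (e x) = f x) {n : ℕ} :
    CovDimLE X n ↔ CovDimLE K n := by
  classical
  have key : ∀ {ι : Type u} [Fintype ι] (P : ι → C(K, ℝ)), (∀ z, ∑ i, P i z = 1) →
      ∀ z, ∃ i, P i z ≠ 0 := by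
    intro ι _ P hP z
    by_contra! hcon
    have := hP z
    simp [hcon] at this
  constructor
  · intro h
    apply covDimLE_of_idx
    intro ι _ g hg
    obtain ⟨P, hPg, hP⟩ := exists_normalized g hg
    let c : ℝ := 1 / (2 * ((Fintype.card ι : ℝ) + 1))
    have hc : 0 < c := by positivity
    obtain ⟨k, hk0, hk1, hk2, hk3⟩ := h.idx
      (fun i => (⟨fun x => max ((P i (e x) : ℝ) - c) 0, by fun_prop⟩ : C(X, ℝ))) (by
        intro x
        by_contra! hcon
        have h1 : ∀ i, (P i (e x) : ℝ) ≤ c := by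
          intro i
          have := hcon i
          simp only [ContinuousMap.coe_mk] at this
          have h2 := le_max_left ((P i (e x) : ℝ) - c) 0
          linarith
        have h3 : (1 : ℝ) ≤ Fintype.card ι * c := by
          rw [← hP (e x)]
          calc _ ≤ ∑ i : ι, c := Finset.sum_le_sum fun i _ => h1 i
            _ = _ := by simp
        have h4 : (Fintype.card ι : ℝ) * c < 1 := by
          simp only [c]
          rw [mul_one_div, div_lt_one (by positivity)]
          have : (0 : ℝ) ≤ Fintype.card ι := by positivity
          linarith
        linarith)
    obtain ⟨Q, hQk, hQ⟩ := exists_extended hd hext k hk2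
    refine ⟨Q, ?_, key Q hQ, ?_⟩
    · intro i z hz
      rw [← hPg]
      have : c ≤ (P i z : ℝ) := by
        by_contra! hlt
        have ho : IsOpen {z | Q i z ≠ 0 ∧ (P i z : ℝ) < c} :=
          (isOpen_ne_fun (Q i).continuous continuous_const).inter
            (isOpen_lt (f := fun z => (P i z : ℝ)) (by fun_prop) continuous_const)
        obtain ⟨x, hx1, hx2⟩ := hd.exists_mem_open ho ⟨z, hz, hlt⟩
        have h1 := hk1 i x ((hQk i x).1 hx1)
        simp only [ContinuousMap.coe_mk] at h1
        exact h1 (max_eq_right (by linarith))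
      exact (hc.trans_le this).ne'
    · intro z
      have ho : IsOpen (⋂ i ∈ {i | Q i z ≠ 0}, {z' | Q i z' ≠ 0}) :=
        Set.Finite.isOpen_biInter (Set.toFinite _) fun i _ =>
          isOpen_ne_fun (Q i).continuous continuous_const
      obtain ⟨x, hx⟩ := hd.exists_mem_open ho ⟨z, by
        simp only [mem_iInter]
        exact fun i hi => hi⟩
      refine le_trans (Set.ncard_le_ncard ?_ (Set.toFinite _)) (hk3 x)
      intro i hi
      simp only [mem_iInter] at hx
      exact (hQk i x).1 (hx i hi)
  · intro h
    apply covDimLE_of_idx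
    intro ι _ g hg
    obtain ⟨P, hPg, hP⟩ := exists_extended hd hext g hg
    obtain ⟨k, hk0, hk1, hk2, hk3⟩ := h.idx P (key P hP)
    exact ⟨fun i => (k i).comp ⟨e, he⟩, fun i x hx => (hPg i x).1 (hk1 i (e x) hx),
      fun x => hk2 (e x), fun x => hk3 (e x)⟩

theorem brick_lebesgue {Y : Type u} [TopologicalSpace Y] [CompactSpace Y] [T2Space Y]
    {ι : Type u} (U : ι → Set (unitInterval × Y)) (hU : ∀ i, IsOpen (U i))
    (hc : ∀ x, ∃ i, x ∈ U i) :
    ∃ ε : ℝ, 0 < ε ∧ ∃ (T : Finset Y) (O : T → Set Y), (∀ s, IsOpen (O s)) ∧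
      (∀ y, ∃ s, y ∈ O s) ∧ ∀ (s : T) (t : unitInterval), ∃ i, ∀ t' : unitInterval,
        |(t' : ℝ) - t| < ε → ∀ y ∈ O s, (t', y) ∈ U i := by
  let _ : UniformSpace Y := uniformSpaceOfCompactR1
  obtain ⟨V, hV, hVU⟩ := lebesgue_number_lemma (K := (univ : Set (unitInterval × Y)))
    isCompact_univ hU (fun x _ => mem_iUnion.2 (hc x))
  rw [uniformity_prod_eq_comap_prod, Filter.mem_comap] at hV
  obtain ⟨R, hR, hRV⟩ := hV
  obtain ⟨A, hA, B, hB, hAB⟩ := Filter.mem_prod_iff.1 hR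
  obtain ⟨ε, hε, hεA⟩ := Metric.mem_uniformity_dist.1 hA
  obtain ⟨T, hT⟩ := CompactSpace.elim_nhds_subcover
    (fun y : Y => interior (UniformSpace.ball y B))
    (fun y => interior_mem_nhds.2 (UniformSpace.ball_mem_nhds y hB))
  refine ⟨ε, hε, T, fun s => interior (UniformSpace.ball s.1 B), fun s => isOpen_interior, ?_, ?_⟩
  · intro y
    have : y ∈ ⋃ x ∈ T, interior (UniformSpace.ball x B) := hT ▸ mem_univ y
    simp only [mem_iUnion] at this
    obtain ⟨x, hx, hy⟩ := this
    exact ⟨⟨x, hx⟩, hy⟩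
  · intro s t
    obtain ⟨i, hi⟩ := hVU (t, s.1) trivial
    refine ⟨i, fun t' ht' y hy => hi ?_⟩
    apply hRV
    apply hAB
    refine ⟨?_, interior_subset (s := UniformSpace.ball s.1 B) hy⟩
    apply hεA
    rw [dist_comm, Subtype.dist_eq, Real.dist_eq]
    exact ht'

theorem CovDimLE.interval_prod {Y : Type u} [TopologicalSpace Y] [CompactSpace Y] [T2Space Y]
    {n : ℕ} (h : CovDimLE Y n) : CovDimLE (unitInterval × Y) (n + 1) := by
  classical
  apply Good.covDimLE
  intro ι _ U hU hc
  obtain ⟨ε, hε, T, O, hO, hOc, hOU⟩ := brick_lebesgue U hU hc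
  obtain ⟨V, hV, hVO, hVc, W, hW, hWu, hVn⟩ := h.good T O hO hOc
  obtain ⟨m, hm⟩ := exists_nat_gt (2 / ε)
  have hm0 : (0 : ℝ) < m := (by positivity : (0 : ℝ) < 2 / ε).trans hm
  have hmε : 2 / (m : ℝ) < ε := by
    rw [div_lt_iff₀ hε] at hm
    rw [div_lt_iff₀ hm0]
    linarith
  let N := Fintype.card T
  let q : T ≃ Fin N := Fintype.equivFin T
  let a : T → unitInterval → ℝ := fun s t => t * m - (q s : ℕ) / (N : ℝ)
  have ha : ∀ s, Continuous (a s) := fun s => by fun_prop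
  have hN : T → (0 : ℝ) < N := fun s => by
    have : 0 < N := (Nat.zero_le _).trans_lt (q s).2
    exact_mod_cast this
  let J : T → Fin (m + 1) → Set unitInterval := fun s j =>
    {t | (j : ℕ) - 1 < a s t ∧ a s t < (j : ℕ) + 1 / (2 * (N : ℝ))}
  have hJ : ∀ s j, IsOpen (J s j) := fun s j =>
    (isOpen_lt continuous_const (ha s)).inter (isOpen_lt (ha s) continuous_const)
  have hhalf : ∀ s : T, 1 / (2 * (N : ℝ)) ≤ 1 / 2 := by
    intro s
    have h1 := hN s
    have h2 : (1 : ℝ) ≤ N := by exact_mod_cast (by exact_mod_cast h1 : 0 < N)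
    rw [div_le_div_iff₀ (by positivity) (by norm_num)]
    linarith
  have hJc : ∀ s t, ∃ j, t ∈ J s j := by
    intro s t
    have h1 := hN s
    have hq : ((q s : ℕ) : ℝ) / N < 1 := by
      rw [div_lt_one h1]
      exact_mod_cast (q s).2
    have hq0 : (0 : ℝ) ≤ ((q s : ℕ) : ℝ) / N := by positivity
    have ht0 := t.2.1
    have ht1 := t.2.2
    have h2 : -1 < a s t := by
      simp only [a]
      nlinarith
    have h3 : a s t ≤ m := by
      simp only [a]
      nlinarith
    have h4 : -1 < ⌈a s t⌉ := by
      have := Int.le_ceil (a s t)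
      exact_mod_cast h2.trans_le this
    have h5 : ⌈a s t⌉ ≤ m := Int.ceil_le.2 (by exact_mod_cast h3)
    obtain ⟨j, hj⟩ := Int.eq_ofNat_of_zero_le (show 0 ≤ ⌈a s t⌉ by omega)
    refine ⟨⟨j, by omega⟩, ?_, ?_⟩
    · have := Int.ceil_lt_add_one (a s t)
      rw [hj] at this
      push_cast at this
      simp only
      linarith
    · have := Int.le_ceil (a s t)
      rw [hj] at this
      push_cast at this
      have h6 : 0 < 1 / (2 * (N : ℝ)) := by positivity
      simp only
      linarith
  have hr : ∀ p : T × Fin (m + 1), ∃ i, ∀ t ∈ J p.1 p.2, ∀ y ∈ O p.1, (t, y) ∈ U i := by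
    rintro ⟨s, j⟩
    by_cases hne : (J s j).Nonempty
    · obtain ⟨t, ht⟩ := hne
      obtain ⟨i, hi⟩ := hOU s t
      refine ⟨i, fun t' ht' y hy => hi t' ?_ y hy⟩
      have h1 : |(t' : ℝ) * m - t * m| < 2 := by
        have h2 := ht.1
        have h3 := ht.2
        have h4 := ht'.1
        have h5 := ht'.2
        have h6 := hhalf s
        simp only [a] at h2 h3 h4 h5
        rw [abs_lt]
        constructor <;> linarith
      rw [← sub_mul, abs_mul, abs_of_pos hm0, ← lt_div_iff₀ hm0] at h1
      exact h1.trans hmε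
    · obtain ⟨i, _⟩ := hOU s 0
      exact ⟨i, fun t ht => absurd ⟨t, ht⟩ hne⟩
  choose r hr using hr
  have hcount : ∀ (t : unitInterval) (y : Y),
      {p : T × Fin (m + 1) | t ∈ J p.1 p.2 ∧ y ∈ V p.1}.ncard ≤ n + 2 := by
    intro t y
    let β : T × Fin (m + 1) → Option T := fun p =>
      if ((p.2 : ℕ) : ℤ) = ⌈a p.1 t⌉ then some p.1 else none
    have hinj : InjOn β {p : T × Fin (m + 1) | t ∈ J p.1 p.2 ∧ y ∈ V p.1} := by
      have hspec : ∀ p : T × Fin (m + 1), t ∈ J p.1 p.2 → ((p.2 : ℕ) : ℤ) ≠ ⌈a p.1 t⌉ →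
          ((p.2 : ℕ) : ℝ) < a p.1 t ∧ a p.1 t < (p.2 : ℕ) + 1 / (2 * (N : ℝ)) := by
        rintro ⟨s, j⟩ ht hne
        refine ⟨?_, ht.2⟩
        by_contra! hle
        apply hne
        symm
        rw [Int.ceil_eq_iff]
        exact ⟨by exact_mod_cast ht.1, by exact_mod_cast hle⟩
      rintro ⟨s, j⟩ hp ⟨s', j'⟩ hp' heq
      simp only [β] at heq
      split_ifs at heq with h1 h2 h2
      · simp only [Option.some.injEq] at heq
        subst heq
        have : (j : ℕ) = j' := by
          have := h1.trans h2.symm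
          exact_mod_cast this
        rw [Fin.ext this]
      · obtain ⟨b1, b2⟩ := hspec _ hp.1 h1
        obtain ⟨b3, b4⟩ := hspec _ hp'.1 h2
        simp only [a] at b1 b2 b3 b4
        have hN' := hN s
        have hNn : (1 / (2 * (N : ℝ))) * N = 1 / 2 := by field_simp
        have e1 : ((q s : ℕ) : ℝ) / N * N = (q s : ℕ) := by field_simp
        have e2 : ((q s' : ℕ) : ℝ) / N * N = (q s' : ℕ) := by field_simp
        have c1 := mul_lt_mul_of_pos_right b1 hN'
        have c2 := mul_lt_mul_of_pos_right b2 hN'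
        have c3 := mul_lt_mul_of_pos_right b3 hN'
        have c4 := mul_lt_mul_of_pos_right b4 hN'
        rw [sub_mul, e1] at c1 c2
        rw [sub_mul, e2] at c3 c4
        rw [add_mul, hNn] at c2 c4
        have d1 : (((j : ℕ) * N + q s : ℕ) : ℝ) < ((j' : ℕ) * N + q s' : ℕ) + 1 := by
          push_cast
          linarith
        have d2 : (((j' : ℕ) * N + q s' : ℕ) : ℝ) < ((j : ℕ) * N + q s : ℕ) + 1 := by
          push_cast
          linarith
        have d1' : (j : ℕ) * N + q s < ((j' : ℕ) * N + q s') + 1 := by exact_mod_cast d1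
        have d2' : (j' : ℕ) * N + q s' < ((j : ℕ) * N + q s) + 1 := by exact_mod_cast d2
        have d3 : (j : ℕ) * N + q s = (j' : ℕ) * N + q s' := by omega
        have d4 := congrArg (· % N) d3
        simp only [Nat.mul_add_mod_self_right, Nat.mod_eq_of_lt (q s).2,
          Nat.mod_eq_of_lt (q s').2] at d4
        have d5 : s = s' := q.injective (Fin.ext d4)
        subst d5
        have hNn0 : 0 < N := by exact_mod_cast hN'
        have d6 : (j : ℕ) = j' := Nat.eq_of_mul_eq_mul_right hNn0 (by omega)
        rw [Fin.ext d6]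
    rw [← hinj.ncard_image]
    have hsub : β '' {p : T × Fin (m + 1) | t ∈ J p.1 p.2 ∧ y ∈ V p.1} ⊆
        insert none (some '' {s | y ∈ V s}) := by
      rintro _ ⟨p, hp, rfl⟩
      simp only [β]
      split_ifs
      · exact Or.inr ⟨p.1, hp.2, rfl⟩
      · exact Or.inl rfl
    refine (Set.ncard_le_ncard hsub (Set.toFinite _)).trans ?_
    refine (Set.ncard_insert_le _ _).trans ?_
    have := (Set.ncard_image_le (f := some) (Set.toFinite {s | y ∈ V s})).trans
      (hVn y (hWu trivial))
    omega
  refine ⟨fun i => ⋃ p ∈ {p | r p = i}, J p.1 p.2 ×ˢ V p.1, ?_, ?_, ?_, univ, isOpen_univ,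
    le_rfl, ?_⟩
  · exact fun i => isOpen_biUnion fun p _ => (hJ _ _).prod (hV _)
  · intro i x hx
    simp only [mem_iUnion] at hx
    obtain ⟨p, rfl, hx⟩ := hx
    exact hr p x.1 hx.1 x.2 (hVO _ hx.2)
  · rintro ⟨t, y⟩
    obtain ⟨s, hs⟩ := hVc y
    obtain ⟨j, hj⟩ := hJc s t
    refine ⟨r (s, j), ?_⟩
    simp only [mem_iUnion]
    exact ⟨(s, j), rfl, hj, hs⟩
  · rintro ⟨t, y⟩ _
    refine le_trans ?_ ((Set.ncard_image_le (f := r) (Set.toFinite _)).trans (hcount t y))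
    refine Set.ncard_le_ncard ?_ (Set.toFinite _)
    intro i hi
    simp only [mem_iUnion, mem_ofPred_eq] at hi
    obtain ⟨p, hp, hx⟩ := hi
    exact ⟨p, ⟨hx.1, hx.2⟩, hp⟩

theorem CovDimLE.cube_prod {Y : Type u} [TopologicalSpace Y] [CompactSpace Y] [T2Space Y]
    {n : ℕ} (h : CovDimLE Y n) (k : ℕ) : CovDimLE ((Fin k → unitInterval) × Y) (n + k) := by
  induction k with
  | zero =>
    refine CovDimLE.of_closedEmbedding h (f := Prod.snd) ?_
    apply Continuous.isClosedEmbedding continuous_snd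
    rintro ⟨a, b⟩ ⟨a', b'⟩ hab
    exact Prod.ext (Subsingleton.elim _ _) hab
  | succ k ih =>
    refine CovDimLE.of_closedEmbedding ih.interval_prod
      (f := fun p => (p.1 0, (fun i => p.1 i.succ, p.2))) ?_
    apply Continuous.isClosedEmbedding (by fun_prop)
    rintro ⟨a, b⟩ ⟨a', b'⟩ hab
    simp only [Prod.mk.injEq] at hab
    refine Prod.ext ?_ hab.2.2
    funext i
    refine Fin.cases hab.1 (fun i => congrFun hab.2.1 i) i

theorem covDimLE_stoneCech_iff {X : Type u} [TopologicalSpace X] {n : ℕ} :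
    CovDimLE X n ↔ CovDimLE (StoneCech X) n :=
  covDimLE_iff_of_ext denseRange_stoneCechUnit continuous_stoneCechUnit fun f =>
    ⟨⟨stoneCechExtend f.continuous, continuous_stoneCechExtend _⟩,
      fun x => congrFun (stoneCechExtend_extends f.continuous) x⟩

theorem CountablyCompact.exists_subseq {X : Type u} [TopologicalSpace X]
    [FirstCountableTopology X] (h : CountablyCompact X) (x : ℕ → X) :
    ∃ (a : X) (φ : ℕ → ℕ), StrictMono φ ∧ Filter.Tendsto (x ∘ φ) Filter.atTop (𝓝 a) := by
  suffices H : ∃ a, MapClusterPt a Filter.atTop x by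
    obtain ⟨a, ha⟩ := H
    obtain ⟨φ, hφ, hφ'⟩ := MapClusterPt.tendsto_subseq ha
    exact ⟨a, φ, hφ, hφ'⟩
  by_contra! hcon
  obtain ⟨t, ht⟩ := h (fun n => (closure (x '' Ici n))ᶜ) (fun n => isClosed_closure.isOpen_compl) (by
    ext a
    simp only [mem_iUnion, mem_univ, iff_true]
    by_contra! hall
    apply hcon a
    rw [mapClusterPt_iff_frequently]
    intro s hs
    rw [Filter.frequently_atTop]
    intro n
    have := hall n
    rw [mem_compl_iff, not_not, mem_closure_iff_nhds] at this
    obtain ⟨_, h1, k, hk, rfl⟩ := this s hs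
    exact ⟨k, hk, h1⟩)
  have : x (t.sup id) ∈ ⋃ n ∈ t, (closure (x '' Ici n))ᶜ := ht ▸ mem_univ _
  simp only [mem_iUnion] at this
  obtain ⟨n, hn, hx⟩ := this
  exact hx (subset_closure ⟨_, Finset.le_sup (f := id) hn, rfl⟩)

theorem glicksberg {X Y : Type u} [TopologicalSpace X] [TopologicalSpace Y]
    [FirstCountableTopology X] [FirstCountableTopology Y]
    (hX : CountablyCompact X) (hY : CountablyCompact Y) (f : C(X × Y, unitInterval)) :
    ∃ F : C(StoneCech X × StoneCech Y, unitInterval),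
      ∀ p : X × Y, F (Prod.map stoneCechUnit stoneCechUnit p) = f p := by
  have hc : ∀ x, Continuous fun y => f (x, y) := fun x => by fun_prop
  let G : X → C(StoneCech Y, unitInterval) := fun x =>
    ⟨stoneCechExtend (hc x), continuous_stoneCechExtend _⟩
  have hG : ∀ x y, G x (stoneCechUnit y) = f (x, y) := fun x y =>
    congrFun (stoneCechExtend_extends (hc x)) y
  have hdist : ∀ x x' (ε : ℝ), 0 ≤ ε → (∀ y, dist (f (x, y)) (f (x', y)) ≤ ε) →
      dist (G x) (G x') ≤ ε := by
    intro x x' ε hε hle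
    rw [ContinuousMap.dist_le hε]
    intro z
    have hcl : IsClosed {z | dist (G x z) (G x' z) ≤ ε} :=
      isClosed_le (by fun_prop) continuous_const
    refine denseRange_stoneCechUnit.induction_on z hcl ?_
    intro y
    simp only [hG]
    exact hle y
  have hGc : Continuous G := by
    rw [continuous_iff_seqContinuous]
    intro u a hu
    rw [Metric.tendsto_atTop]
    intro ε hε
    by_contra! hcon
    have hbad : ∀ N, ∃ n ≥ N, ∃ y, ε / 2 < dist (f (u n, y)) (f (a, y)) := by
      intro N
      obtain ⟨n, hn, hd⟩ := hcon N
      refine ⟨n, hn, ?_⟩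
      by_contra! hle
      have := hdist (u n) a (ε / 2) (by positivity) hle
      have hd' : ε ≤ dist (G (u n)) (G a) := hd
      linarith
    choose n hn y hy using hbad
    obtain ⟨b, φ, hφ, hb⟩ := hY.exists_subseq y
    have hnt : Filter.Tendsto n Filter.atTop Filter.atTop :=
      Filter.tendsto_atTop_mono hn Filter.tendsto_id
    have hua : Filter.Tendsto (fun k => u (n (φ k))) Filter.atTop (𝓝 a) :=
      hu.comp (hnt.comp hφ.tendsto_atTop)
    have h1 : Filter.Tendsto (fun k => f (u (n (φ k)), y (φ k))) Filter.atTop (𝓝 (f (a, b))) :=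
      (f.continuous.tendsto (a, b)).comp (hua.prodMk_nhds hb)
    have h2 : Filter.Tendsto (fun k => f (a, y (φ k))) Filter.atTop (𝓝 (f (a, b))) :=
      (f.continuous.tendsto (a, b)).comp (tendsto_const_nhds.prodMk_nhds hb)
    have h3 := h1.dist h2
    rw [dist_self] at h3
    have h4 := ge_of_tendsto h3 (Filter.Eventually.of_forall fun k => (hy (φ k)).le)
    linarith
  have hcomp : IsCompact (range G) := by
    apply IsSeqCompact.isCompact
    intro u hu
    choose v hv using hu
    obtain ⟨a, φ, hφ, ha⟩ := hX.exists_subseq v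
    refine ⟨G a, ⟨a, rfl⟩, φ, hφ, ?_⟩
    have := (hGc.tendsto a).comp ha
    refine this.congr fun k => ?_
    simp [hv]
  have : CompactSpace (range G) := isCompact_iff_compactSpace.1 hcomp
  have hG' : Continuous (fun x => (⟨G x, x, rfl⟩ : range G)) := hGc.subtype_mk _
  let E : C(StoneCech X, C(StoneCech Y, unitInterval)) :=
    ⟨fun z => (stoneCechExtend hG' z).1, continuous_subtype_val.comp (continuous_stoneCechExtend _)⟩
  refine ⟨⟨_, ContinuousMap.continuous_uncurry_of_continuous E⟩, ?_⟩
  rintro ⟨x, y⟩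
  have h1 : E (stoneCechUnit x) = G x :=
    congrArg Subtype.val (congrFun (stoneCechExtend_extends hG') x)
  simp only [Prod.map, ContinuousMap.coe_mk, Function.uncurry]
  rw [h1, hG]

theorem covDimLE_prod_stoneCech_iff {X Y : Type u} [TopologicalSpace X] [TopologicalSpace Y]
    [FirstCountableTopology X] [FirstCountableTopology Y]
    (hX : CountablyCompact X) (hY : CountablyCompact Y) {n : ℕ} :
    CovDimLE (X × Y) n ↔ CovDimLE (StoneCech X × StoneCech Y) n :=
  covDimLE_iff_of_ext (denseRange_stoneCechUnit.prodMap denseRange_stoneCechUnit)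
    (continuous_stoneCechUnit.prodMap continuous_stoneCechUnit) (glicksberg hX hY)

theorem IsTopManifold.chart {M : Type u} [TopologicalSpace M] {n : ℕ} (h : IsTopManifold M n)
    (x : M) : ∃ φ : EuclideanSpace ℝ (Fin n) → M, IsOpenEmbedding φ ∧ ∃ z, φ z = x := by
  obtain ⟨U, hU, hx, ⟨e⟩⟩ := h x
  exact ⟨Subtype.val ∘ e.symm, hU.isOpenEmbedding_subtypeVal.comp e.symm.isOpenEmbedding,
    e ⟨x, hx⟩, by simp⟩

theorem IsTopManifold.firstCountable {M : Type u} [TopologicalSpace M] {n : ℕ}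
    (h : IsTopManifold M n) : FirstCountableTopology M := by
  refine ⟨fun x => ?_⟩
  obtain ⟨φ, hφ, z, rfl⟩ := h.chart x
  rw [← hφ.map_nhds_eq]
  infer_instance

theorem IsTopManifold.cube {M : Type u} [TopologicalSpace M] {n : ℕ}
    (h : IsTopManifold M n) (x : M) : ∃ c : (Fin n → unitInterval) → M, Continuous c ∧
      Function.Injective c ∧ range c ∈ 𝓝 x := by
  obtain ⟨φ, hφ, z, rfl⟩ := h.chart x
  refine ⟨fun v => φ (z + WithLp.toLp 2 (fun i => (v i : ℝ) - 1 / 2)), ?_, ?_, ?_⟩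
  · apply hφ.continuous.comp
    fun_prop
  · intro v v' hv
    have h1 := add_left_cancel (hφ.injective hv)
    funext i
    have h2 := congrArg (fun w : EuclideanSpace ℝ (Fin n) => w i) h1
    simp only at h2
    exact Subtype.ext (by linarith)
  · rw [← hφ.map_nhds_eq, Filter.mem_map]
    have hev : ∀ᶠ w in 𝓝 z, ∀ i, |w i - z i| < 1 / 2 := by
      rw [Filter.eventually_all]
      intro i
      have hco : Continuous fun w : EuclideanSpace ℝ (Fin n) => |w i - z i| := by fun_prop
      exact hco.continuousAt.eventually_lt continuousAt_const (by simp)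
    filter_upwards [hev] with w hw
    refine ⟨fun i => ⟨w i - z i + 1 / 2, ?_⟩, ?_⟩
    · have := abs_lt.1 (hw i)
      constructor <;> linarith
    · refine congrArg φ ?_
      ext i
      simp

theorem range_unit_comp_mem_nhds {M : Type u} [TopologicalSpace M] [T35Space M] {K : Type w}
    [TopologicalSpace K] [CompactSpace K] {c : K → M} (hc : Continuous c) {x : M}
    (hx : range c ∈ 𝓝 x) : range (stoneCechUnit ∘ c) ∈ 𝓝 (stoneCechUnit x : StoneCech M) := by
  have hind : IsInducing (stoneCechUnit : M → StoneCech M) :=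
    isDenseEmbedding_stoneCechUnit.toIsDenseInducing.isInducing
  obtain ⟨V, hVc, hV, hxV⟩ := mem_nhds_iff.1 hx
  obtain ⟨O, hO, rfl⟩ := hind.isOpen_iff.1 hV
  have hcl : IsClosed (range (stoneCechUnit ∘ c)) :=
    (isCompact_range (continuous_stoneCechUnit.comp hc)).isClosed
  refine Filter.mem_of_superset (hO.mem_nhds hxV) ?_
  refine (denseRange_stoneCechUnit.open_subset_closure_inter hO).trans ?_
  rw [← hcl.closure_eq]
  apply closure_mono
  rintro _ ⟨hO', y, rfl⟩
  obtain ⟨k, rfl⟩ := hVc hO'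
  exact ⟨k, rfl⟩

theorem IsTopManifold.isClosed_remainder {M : Type u} [TopologicalSpace M] [T35Space M] {n : ℕ}
    (h : IsTopManifold M n) : IsClosed (StoneCechRemainder M) := by
  rw [StoneCechRemainder, isClosed_compl_iff, isOpen_iff_mem_nhds]
  rintro _ ⟨x, rfl⟩
  obtain ⟨c, hc, _, hx⟩ := h.cube x
  refine Filter.mem_of_superset (range_unit_comp_mem_nhds hc hx) ?_
  rintro _ ⟨k, rfl⟩
  exact ⟨c k, rfl⟩

theorem covDimLE_of_covDim_eq {X : Type*} [TopologicalSpace X] {m : ℕ}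
    (h : covDim X = (m : ℕ∞)) : CovDimLE X m := by
  have hne : (((↑) : ℕ → ℕ∞) '' {n : ℕ | CovDimLE X n}).Nonempty := by
    by_contra hemp
    rw [Set.not_nonempty_iff_eq_empty] at hemp
    rw [covDim, hemp, sInf_empty] at h
    exact ENat.top_ne_natCast m h
  obtain ⟨n, hn, hnm⟩ := csInf_mem hne
  have : (n : ℕ∞) = m := hnm.trans h
  rwa [← Nat.cast_injective this]

theorem covDimLE_prod_remainder_iff (M₁ : Type u) (M₂ : Type u)
    [TopologicalSpace M₁] [TopologicalSpace M₂] [T35Space M₁] [T35Space M₂]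
    (n₁ n₂ m₁ m₂ : ℕ)
    (hM₁ : IsTopManifold M₁ n₁) (hM₂ : IsTopManifold M₂ n₂)
    (h₁ : CountablyCompact M₁) (h₂ : CountablyCompact M₂)
    (hd₁ : covDim M₁ = (m₁ : ℕ∞)) (hd₂ : covDim M₂ = (m₂ : ℕ∞))
    (hle : max ((n₁ + m₂ : ℕ) : ℕ∞) ((n₂ + m₁ : ℕ) : ℕ∞) ≤
      covDim (↥(StoneCechRemainder M₁) × ↥(StoneCechRemainder M₂))) (k : ℕ) :
    CovDimLE (M₁ × M₂) k ↔ CovDimLE (↥(StoneCechRemainder M₁) × ↥(StoneCechRemainder M₂)) k := by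
  have := hM₁.firstCountable
  have := hM₂.firstCountable
  rw [covDimLE_prod_stoneCech_iff h₁ h₂]
  have hemb : IsClosedEmbedding (Prod.map Subtype.val Subtype.val :
      ↥(StoneCechRemainder M₁) × ↥(StoneCechRemainder M₂) → StoneCech M₁ × StoneCech M₂) :=
    hM₁.isClosed_remainder.isClosedEmbedding_subtypeVal.prodMap
      hM₂.isClosed_remainder.isClosedEmbedding_subtypeVal
  refine ⟨fun h => h.of_closedEmbedding hemb, fun h => ?_⟩
  have hk : covDim (↥(StoneCechRemainder M₁) × ↥(StoneCechRemainder M₂)) ≤ (k : ℕ∞) :=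
    sInf_le ⟨k, h, rfl⟩
  have hk' := hle.trans hk
  rw [max_le_iff, Nat.cast_le, Nat.cast_le] at hk'
  have hc₂ : CovDimLE ((Fin n₁ → unitInterval) × StoneCech M₂) k :=
    ((covDimLE_stoneCech_iff.1 (covDimLE_of_covDim_eq hd₂)).cube_prod n₁).mono (by omega)
  have hc₁ : CovDimLE ((Fin n₂ → unitInterval) × StoneCech M₁) k :=
    ((covDimLE_stoneCech_iff.1 (covDimLE_of_covDim_eq hd₁)).cube_prod n₂).mono (by omega)
  have hi₁ : Function.Injective (stoneCechUnit : M₁ → StoneCech M₁) :=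
    isDenseEmbedding_stoneCechUnit.injective
  have hi₂ : Function.Injective (stoneCechUnit : M₂ → StoneCech M₂) :=
    isDenseEmbedding_stoneCechUnit.injective
  apply Good.covDimLE
  refine good_univ_of_local (h.good_range hemb) ?_
  rintro ⟨p, q⟩ hpq
  have hor : p ∈ range (stoneCechUnit : M₁ → StoneCech M₁) ∨
      q ∈ range (stoneCechUnit : M₂ → StoneCech M₂) := by
    by_contra! hcon
    exact hpq ⟨(⟨p, hcon.1⟩, ⟨q, hcon.2⟩), rfl⟩
  rcases hor with ⟨x, rfl⟩ | ⟨x, rfl⟩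
  · obtain ⟨c, hc, hci, hx⟩ := hM₁.cube x
    have hf : IsClosedEmbedding (fun z : (Fin n₁ → unitInterval) × StoneCech M₂ =>
        ((stoneCechUnit (c z.1) : StoneCech M₁), z.2)) := by
      apply Continuous.isClosedEmbedding
      · exact (continuous_stoneCechUnit.comp (hc.comp continuous_fst)).prodMk continuous_snd
      · rintro ⟨a, b⟩ ⟨a', b'⟩ hab
        simp only [Prod.mk.injEq] at hab
        exact Prod.ext (hci (hi₁ hab.1)) hab.2
    refine ⟨_, ?_, hc₂.good_range hf⟩
    refine Filter.mem_of_superset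
      (prod_mem_nhds (range_unit_comp_mem_nhds hc hx) Filter.univ_mem) ?_
    rintro ⟨_, b⟩ ⟨⟨a, rfl⟩, _⟩
    exact ⟨(a, b), rfl⟩
  · obtain ⟨c, hc, hci, hx⟩ := hM₂.cube x
    have hf : IsClosedEmbedding (fun z : (Fin n₂ → unitInterval) × StoneCech M₁ =>
        (z.2, (stoneCechUnit (c z.1) : StoneCech M₂))) := by
      apply Continuous.isClosedEmbedding
      · exact continuous_snd.prodMk (continuous_stoneCechUnit.comp (hc.comp continuous_fst))
      · rintro ⟨a, b⟩ ⟨a', b'⟩ hab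
        simp only [Prod.mk.injEq] at hab
        exact Prod.ext (hci (hi₂ hab.2)) hab.1
    refine ⟨_, ?_, hc₁.good_range hf⟩
    refine Filter.mem_of_superset
      (prod_mem_nhds Filter.univ_mem (range_unit_comp_mem_nhds hc hx)) ?_
    rintro ⟨b, _⟩ ⟨_, ⟨a, rfl⟩⟩
    exact ⟨(a, b), rfl⟩

/-- If `max {n₁ + m₂, n₂ + m₁} ≤ dim (M₁* × M₂*)`, then
`dim (M₁ × M₂) = dim (M₁* × M₂*)` for countably compact normal manifolds. -/
theorem covDim_prod_eq_covDim_remainder_prod (M₁ : Type u) (M₂ : Type u)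
    [TopologicalSpace M₁] [TopologicalSpace M₂] [NormalSpace M₁] [NormalSpace M₂]
    [T35Space M₁] [T35Space M₂] [Nonempty M₁] [Nonempty M₂]
    (n₁ n₂ m₁ m₂ : ℕ)
    (hM₁ : IsTopManifold M₁ n₁) (hM₂ : IsTopManifold M₂ n₂)
    (h₁ : CountablyCompact M₁) (h₂ : CountablyCompact M₂)
    (hd₁ : covDim M₁ = (m₁ : ℕ∞)) (hd₂ : covDim M₂ = (m₂ : ℕ∞))
    (hle : max ((n₁ + m₂ : ℕ) : ℕ∞) ((n₂ + m₁ : ℕ) : ℕ∞) ≤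
      covDim (↥(StoneCechRemainder M₁) × ↥(StoneCechRemainder M₂))) :
    covDim (M₁ × M₂) =
      covDim (↥(StoneCechRemainder M₁) × ↥(StoneCechRemainder M₂)) := by
  have h := covDimLE_prod_remainder_iff M₁ M₂ n₁ n₂ m₁ m₂ hM₁ hM₂ h₁ h₂ hd₁ hd₂ hle
  simp only [covDim, h]
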